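/- Let ρ > 0 and let x = (x₁, x₂) ∈ ℝ²_↓ not be a scalar multiple of the all-ones vector e (so x₁ > x₂ ≥ 0). Set θ* = ½ arctan(2(ρx₁x₂ − 2)/(ρ(x₁² − x₂²))) if ρx₁x₂ > 2, and θ* = 0 if ρx₁x₂ ≤ 2. Then w* = (cos θ*, sin θ*) is a global minimizer of G(w) := −(ρ/2)⟨x, w⟩² + ‖w‖₁² over S¹₊, and: prox_{(1/ρ)h₂}(x) = {0} if ρx₁x₂ ≤ 2 and ρx₁² < 2; prox_{(1/ρ)h₂}(x) = {0, x₁e₁} if ρx₁x₂ ≤ 2 and ρx₁² = 2; prox_{(1/ρ)h₂}(x) = {x₁e₁} if ρx₁x₂ ≤ 2 and ρx₁² > 2; prox_{(1/ρ)h₂}(x) = {⟨x, w*⟩ w*} if ρx₁x₂ > 2. -/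

import Mathlib

/-- The ℓ₁ norm on `ℝⁿ`. -/
noncomputable def l1norm {n : ℕ} (x : Fin n → ℝ) : ℝ := ∑ i, |x i|

/-- The ℓ₂ norm on `ℝⁿ`. -/
noncomputable def l2norm {n : ℕ} (x : Fin n → ℝ) : ℝ := Real.sqrt (∑ i, (x i) ^ 2)

-- `h₂(x) = (‖x‖₁/‖x‖₂)²` for `x ≠ 0`, and `h₂(0) = 0`.
open Classical in
noncomputable def h2 {n : ℕ} (x : Fin n → ℝ) : ℝ :=
  if x = 0 then 0 else (l1norm x / l2norm x) ^ 2

/-- `prox_{(1/ρ) f}(z)`: the set of global minimizers of `(ρ/2)‖u - z‖₂² + f(u)`. -/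
noncomputable def proxSet {n : ℕ} (ρ : ℝ) (f : (Fin n → ℝ) → ℝ) (z : Fin n → ℝ) :
    Set (Fin n → ℝ) :=
  {u | ∀ v : Fin n → ℝ,
    ρ / 2 * (∑ i, (u i - z i) ^ 2) + f u ≤ ρ / 2 * (∑ i, (v i - z i) ^ 2) + f v}

/-- The profile `1 + 2|pq| - (ρ/2)(ap + bq)²`, which is the value of `-(ρ/2)⟨x, w⟩² + ‖w‖₁²` at a
unit vector `w = (p, q)` when `x = (a, b)`. -/
noncomputable def sphereProfile (ρ a b p q : ℝ) : ℝ :=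
  1 + 2 * |p * q| - ρ / 2 * (a * p + b * q) ^ 2

lemma l1norm_sq_fin_two (w : Fin 2 → ℝ) :
    l1norm w ^ 2 = w 0 ^ 2 + w 1 ^ 2 + 2 * |w 0 * w 1| := by
  rw [l1norm, Fin.sum_univ_two, abs_mul, ← sq_abs (w 0), ← sq_abs (w 1)]
  ring

lemma h2_smul_of_sq_add_sq_eq_one {t p q : ℝ} (ht : t ≠ 0) (h : p ^ 2 + q ^ 2 = 1) :
    h2 ![t * p, t * q] = 1 + 2 * |p * q| := by
  have hs : (t * p) ^ 2 + (t * q) ^ 2 = t ^ 2 := by linear_combination t ^ 2 * h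
  have hne : (![t * p, t * q] : Fin 2 → ℝ) ≠ 0 := by
    intro h0
    have h1 := congrFun h0 0
    have h1' := congrFun h0 1
    simp only [Matrix.cons_val_zero, Matrix.cons_val_one, Pi.zero_apply] at h1 h1'
    rw [h1, h1'] at hs
    exact ht (by simpa using hs.symm)
  have hl2 : l2norm ![t * p, t * q] ^ 2 = t ^ 2 := by
    rw [l2norm, Real.sq_sqrt (by positivity), Fin.sum_univ_two]
    simpa using hs
  have habs : |t * p * (t * q)| = t ^ 2 * |p * q| := by
    rw [show t * p * (t * q) = t ^ 2 * (p * q) by ring, abs_mul, abs_of_nonneg (sq_nonneg t)]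
  rw [h2, if_neg hne, div_pow, hl2, l1norm_sq_fin_two]
  simp only [Matrix.cons_val_zero, Matrix.cons_val_one]
  rw [hs, habs]
  field_simp

lemma exists_smul_unit_of_ne_zero {u : Fin 2 → ℝ} (hu : u ≠ 0) :
    ∃ t p q : ℝ, t ≠ 0 ∧ p ^ 2 + q ^ 2 = 1 ∧ u = ![t * p, t * q] := by
  have hs : 0 < u 0 ^ 2 + u 1 ^ 2 := by
    by_contra! h
    refine hu (funext fun i => ?_)
    fin_cases i <;> simp <;> nlinarith [sq_nonneg (u 0), sq_nonneg (u 1)]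
  have ht := Real.sqrt_pos.2 hs
  refine ⟨√(u 0 ^ 2 + u 1 ^ 2), u 0 / √(u 0 ^ 2 + u 1 ^ 2), u 1 / √(u 0 ^ 2 + u 1 ^ 2),
    ht.ne', ?_, ?_⟩
  · rw [div_pow, div_pow, Real.sq_sqrt hs.le, ← add_div, div_self hs.ne']
  · rw [mul_div_cancel₀ _ ht.ne', mul_div_cancel₀ _ ht.ne']
    ext i
    fin_cases i <;> rfl

lemma prox_objective_smul (ρ : ℝ) (x : Fin 2 → ℝ) {t p q : ℝ} (ht : t ≠ 0)
    (h : p ^ 2 + q ^ 2 = 1) :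
    ρ / 2 * (∑ i, ((![t * p, t * q] : Fin 2 → ℝ) i - x i) ^ 2) + h2 ![t * p, t * q] =
      ρ / 2 * (x 0 ^ 2 + x 1 ^ 2) + sphereProfile ρ (x 0) (x 1) p q
        + ρ / 2 * (t - (x 0 * p + x 1 * q)) ^ 2 := by
  rw [h2_smul_of_sq_add_sq_eq_one ht h, Fin.sum_univ_two, sphereProfile]
  simp only [Matrix.cons_val_zero, Matrix.cons_val_one]
  linear_combination ρ / 2 * t ^ 2 * h

lemma prox_objective_zero (ρ : ℝ) (x : Fin 2 → ℝ) :
    ρ / 2 * (∑ i, ((0 : Fin 2 → ℝ) i - x i) ^ 2) + h2 (0 : Fin 2 → ℝ) =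
      ρ / 2 * (x 0 ^ 2 + x 1 ^ 2) := by
  simp [h2, Fin.sum_univ_two]

/-- `(c, s)` minimizes the profile of `(a, b)` over the unit circle, and every other minimizer has
the same projection of `(a, b)` onto the line it spans. -/
structure IsProfileMin (ρ a b c s : ℝ) : Prop where
  unit : c ^ 2 + s ^ 2 = 1
  inner_ne_zero : a * c + b * s ≠ 0
  le : ∀ p q : ℝ, p ^ 2 + q ^ 2 = 1 → sphereProfile ρ a b c s ≤ sphereProfile ρ a b p q
  projection_eq : ∀ p q : ℝ, p ^ 2 + q ^ 2 = 1 →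
    sphereProfile ρ a b p q ≤ sphereProfile ρ a b c s →
    (a * p + b * q) * p = (a * c + b * s) * c ∧ (a * p + b * q) * q = (a * c + b * s) * s

namespace IsProfileMin

variable {ρ c s : ℝ} {x : Fin 2 → ℝ}

lemma objective_projection (h : IsProfileMin ρ (x 0) (x 1) c s) :
    ρ / 2 * (∑ i, ((![(x 0 * c + x 1 * s) * c, (x 0 * c + x 1 * s) * s] : Fin 2 → ℝ) i
        - x i) ^ 2) + h2 ![(x 0 * c + x 1 * s) * c, (x 0 * c + x 1 * s) * s] =
      ρ / 2 * (x 0 ^ 2 + x 1 ^ 2) + sphereProfile ρ (x 0) (x 1) c s := by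
  rw [prox_objective_smul ρ x h.inner_ne_zero h.unit]
  ring

lemma le_objective (hρ : 0 < ρ) (h : IsProfileMin ρ (x 0) (x 1) c s) {u : Fin 2 → ℝ}
    (hu : u ≠ 0) :
    ρ / 2 * (x 0 ^ 2 + x 1 ^ 2) + sphereProfile ρ (x 0) (x 1) c s ≤
      ρ / 2 * (∑ i, (u i - x i) ^ 2) + h2 u := by
  obtain ⟨t, p, q, ht, hpq, rfl⟩ := exists_smul_unit_of_ne_zero hu
  rw [prox_objective_smul ρ x ht hpq]
  have := h.le p q hpq
  have : 0 ≤ ρ / 2 * (t - (x 0 * p + x 1 * q)) ^ 2 := by positivity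
  linarith

lemma eq_projection (hρ : 0 < ρ) (h : IsProfileMin ρ (x 0) (x 1) c s) {u : Fin 2 → ℝ}
    (hu : u ≠ 0)
    (hle : ρ / 2 * (∑ i, (u i - x i) ^ 2) + h2 u ≤
      ρ / 2 * (x 0 ^ 2 + x 1 ^ 2) + sphereProfile ρ (x 0) (x 1) c s) :
    u = ![(x 0 * c + x 1 * s) * c, (x 0 * c + x 1 * s) * s] := by
  obtain ⟨t, p, q, ht, hpq, rfl⟩ := exists_smul_unit_of_ne_zero hu
  rw [prox_objective_smul ρ x ht hpq] at hle
  have hmin := h.le p q hpq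
  have hsq : 0 ≤ ρ / 2 * (t - (x 0 * p + x 1 * q)) ^ 2 := by positivity
  obtain ⟨e₁, e₂⟩ := h.projection_eq p q hpq (by linarith)
  have h0 : ρ / 2 * (t - (x 0 * p + x 1 * q)) ^ 2 = 0 := by linarith
  have ht' : t = x 0 * p + x 1 * q := by
    have hρ' : ρ / 2 ≠ 0 := by positivity
    have := pow_eq_zero_iff two_ne_zero |>.1 ((mul_eq_zero.1 h0).resolve_left hρ')
    linarith
  rw [ht', e₁, e₂]

lemma projection_ne_zero (h : IsProfileMin ρ (x 0) (x 1) c s) :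
    (![(x 0 * c + x 1 * s) * c, (x 0 * c + x 1 * s) * s] : Fin 2 → ℝ) ≠ 0 := by
  intro h0
  have h1 := congrFun h0 0
  have h1' := congrFun h0 1
  simp only [Matrix.cons_val_zero, Matrix.cons_val_one, Pi.zero_apply, mul_eq_zero,
    h.inner_ne_zero, false_or] at h1 h1'
  have := h.unit
  rw [h1, h1'] at this
  norm_num at this

lemma proxSet_eq_of_pos (hρ : 0 < ρ) (h : IsProfileMin ρ (x 0) (x 1) c s)
    (hpos : 0 < sphereProfile ρ (x 0) (x 1) c s) : proxSet ρ h2 x = {0} := by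
  ext u
  simp only [proxSet, Set.mem_ofPred_eq, Set.mem_singleton_iff]
  constructor
  · intro hmin
    by_contra hu
    have := hmin 0
    rw [prox_objective_zero] at this
    linarith [h.le_objective hρ hu]
  · rintro rfl v
    rw [prox_objective_zero]
    by_cases hv : v = 0
    · rw [hv, prox_objective_zero]
    · linarith [h.le_objective hρ hv]

lemma proxSet_eq_of_eq_zero (hρ : 0 < ρ) (h : IsProfileMin ρ (x 0) (x 1) c s)
    (hzero : sphereProfile ρ (x 0) (x 1) c s = 0) :
    proxSet ρ h2 x = {0, ![(x 0 * c + x 1 * s) * c, (x 0 * c + x 1 * s) * s]} := by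
  have hle (v : Fin 2 → ℝ) :
      ρ / 2 * (x 0 ^ 2 + x 1 ^ 2) ≤ ρ / 2 * (∑ i, (v i - x i) ^ 2) + h2 v := by
    by_cases hv : v = 0
    · rw [hv, prox_objective_zero]
    · linarith [h.le_objective hρ hv]
  ext u
  simp only [proxSet, Set.mem_ofPred_eq, Set.mem_insert_iff, Set.mem_singleton_iff]
  constructor
  · intro hmin
    refine or_iff_not_imp_left.2 fun hu => h.eq_projection hρ hu ?_
    have := hmin 0
    rw [prox_objective_zero] at this
    linarith
  · rintro (rfl | rfl) v
    · rw [prox_objective_zero]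
      exact hle v
    · rw [h.objective_projection, hzero, add_zero]
      exact hle v

lemma proxSet_eq_of_neg (hρ : 0 < ρ) (h : IsProfileMin ρ (x 0) (x 1) c s)
    (hneg : sphereProfile ρ (x 0) (x 1) c s < 0) :
    proxSet ρ h2 x = {![(x 0 * c + x 1 * s) * c, (x 0 * c + x 1 * s) * s]} := by
  ext u
  simp only [proxSet, Set.mem_ofPred_eq, Set.mem_singleton_iff]
  constructor
  · intro hmin
    have hproj := hmin _ |>.trans_eq h.objective_projection
    refine h.eq_projection hρ ?_ hproj
    rintro rfl
    rw [prox_objective_zero] at hproj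
    linarith
  · rintro rfl v
    rw [h.objective_projection]
    by_cases hv : v = 0
    · rw [hv, prox_objective_zero]
      linarith
    · exact h.le_objective hρ hv

end IsProfileMin

lemma isProfileMin_one_zero {ρ a b : ℝ} (hρ : 0 < ρ) (hb : 0 ≤ b) (hab : b < a)
    (h : ρ * a * b ≤ 2) : IsProfileMin ρ a b 1 0 := by
  have hA : 0 < ρ / 2 * (a ^ 2 - b ^ 2) := mul_pos (by positivity) (by nlinarith)
  have key (p q : ℝ) (hpq : p ^ 2 + q ^ 2 = 1) :
      sphereProfile ρ a b 1 0 + ρ / 2 * (a ^ 2 - b ^ 2) * q ^ 2 ≤ sphereProfile ρ a b p q := by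
    have hab' : 0 ≤ ρ * a * b := mul_nonneg (mul_nonneg hρ.le (hb.trans hab.le)) hb
    have hpq' : ρ * a * b * (p * q) ≤ 2 * |p * q| :=
      (mul_le_mul_of_nonneg_left (le_abs_self _) hab').trans
        (mul_le_mul_of_nonneg_right h (abs_nonneg _))
    simp only [sphereProfile, mul_zero, abs_zero]
    linear_combination hpq' + ρ / 2 * a ^ 2 * hpq
  refine ⟨by norm_num, by linarith, fun p q hpq => ?_, fun p q hpq hle => ?_⟩
  · have := key p q hpq
    nlinarith [mul_nonneg hA.le (sq_nonneg q)]
  · have hq : q = 0 := by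
      have := key p q hpq
      by_contra hq
      have : 0 < ρ / 2 * (a ^ 2 - b ^ 2) * q ^ 2 := by positivity
      linarith
    subst hq
    constructor
    · linear_combination a * hpq
    · ring

lemma isProfileMin_of_double_angle {ρ a b c s : ℝ} (hρ : 0 < ρ) (hb : 0 ≤ b) (hab : b < a)
    (hc : 0 < c) (hs : 0 ≤ s) (hcs : c ^ 2 + s ^ 2 = 1) (hcos : 0 < c ^ 2 - s ^ 2)
    (htan : ρ * (a ^ 2 - b ^ 2) * (2 * c * s) = 2 * (ρ * a * b - 2) * (c ^ 2 - s ^ 2)) :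
    IsProfileMin ρ a b c s := by
  have hA : 0 < ρ * (a ^ 2 - b ^ 2) := mul_pos hρ (by nlinarith)
  have key (p q : ℝ) (hpq : p ^ 2 + q ^ 2 = 1) :
      ρ * (a ^ 2 - b ^ 2) * (((p ^ 2 - q ^ 2) - (c ^ 2 - s ^ 2)) ^ 2
        + (2 * p * q - 2 * c * s) ^ 2) ≤
      8 * (c ^ 2 - s ^ 2) * (sphereProfile ρ a b p q - sphereProfile ρ a b c s) := by
    have hlow : 1 - ρ / 4 * (a ^ 2 + b ^ 2) - (ρ * (a ^ 2 - b ^ 2) * (p ^ 2 - q ^ 2)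
        + 2 * (ρ * a * b - 2) * (2 * p * q)) / 4 ≤ sphereProfile ρ a b p q := by
      rw [sphereProfile]
      linear_combination 2 * le_abs_self (p * q) + ρ / 4 * (a ^ 2 + b ^ 2) * hpq
    have heq : sphereProfile ρ a b c s = 1 - ρ / 4 * (a ^ 2 + b ^ 2)
        - (ρ * (a ^ 2 - b ^ 2) * (c ^ 2 - s ^ 2) + 2 * (ρ * a * b - 2) * (2 * c * s)) / 4 := by
      rw [sphereProfile, abs_of_nonneg (mul_nonneg hc.le hs)]
      linear_combination -(ρ / 4 * (a ^ 2 + b ^ 2)) * hcs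
    have hpq4 : (p ^ 2 - q ^ 2) ^ 2 + (2 * p * q) ^ 2 = 1 := by
      linear_combination (p ^ 2 + q ^ 2 + 1) * hpq
    have hcs4 : (c ^ 2 - s ^ 2) ^ 2 + (2 * c * s) ^ 2 = 1 := by
      linear_combination (c ^ 2 + s ^ 2 + 1) * hcs
    refine le_trans (le_of_eq ?_)
      (mul_le_mul_of_nonneg_left (sub_le_sub hlow heq.le) (by positivity))
    linear_combination ρ * (a ^ 2 - b ^ 2) * (hpq4 - hcs4)
      + 2 * (2 * c * s - 2 * p * q) * htan
  refine ⟨hcs, by nlinarith [mul_nonneg hb hs], fun p q hpq => ?_, fun p q hpq hle => ?_⟩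
  · have h0 := (show 0 ≤ ρ * (a ^ 2 - b ^ 2) * (((p ^ 2 - q ^ 2) - (c ^ 2 - s ^ 2)) ^ 2
        + (2 * p * q - 2 * c * s) ^ 2) by positivity).trans (key p q hpq)
    exact sub_nonneg.1 (nonneg_of_mul_nonneg_right h0 (by positivity))
  · have h0 := (key p q hpq).trans
      (mul_nonpos_of_nonneg_of_nonpos (by positivity) (sub_nonpos.2 hle))
    have h1 := nonpos_of_mul_nonpos_right h0 hA
    have hC : p ^ 2 - q ^ 2 = c ^ 2 - s ^ 2 := by
      nlinarith [sq_nonneg (p ^ 2 - q ^ 2 - (c ^ 2 - s ^ 2)), sq_nonneg (2 * p * q - 2 * c * s)]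
    have hS : p * q = c * s := by
      nlinarith [sq_nonneg (p ^ 2 - q ^ 2 - (c ^ 2 - s ^ 2)), sq_nonneg (2 * p * q - 2 * c * s)]
    constructor
    · linear_combination a / 2 * (hC + hpq - hcs) + b * hS
    · linear_combination a * hS + b / 2 * (hpq - hcs - hC)

lemma half_arctan_double_angle {t : ℝ} (ht : 0 ≤ t) :
    0 < Real.cos (1 / 2 * Real.arctan t) ∧ 0 ≤ Real.sin (1 / 2 * Real.arctan t) ∧
      0 < Real.cos (1 / 2 * Real.arctan t) ^ 2 - Real.sin (1 / 2 * Real.arctan t) ^ 2 ∧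
      2 * Real.cos (1 / 2 * Real.arctan t) * Real.sin (1 / 2 * Real.arctan t) =
        t * (Real.cos (1 / 2 * Real.arctan t) ^ 2 - Real.sin (1 / 2 * Real.arctan t) ^ 2) := by
  have h0 : 0 ≤ Real.arctan t := Real.arctan_nonneg.2 ht
  have h1 := Real.arctan_lt_pi_div_two t
  have hcos : Real.cos (1 / 2 * Real.arctan t) ^ 2 - Real.sin (1 / 2 * Real.arctan t) ^ 2 =
      Real.cos (Real.arctan t) := by
    rw [← Real.cos_two_mul']
    ring_nf
  have hsin : 2 * Real.cos (1 / 2 * Real.arctan t) * Real.sin (1 / 2 * Real.arctan t) =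
      Real.sin (Real.arctan t) := by
    rw [mul_right_comm, ← Real.sin_two_mul]
    ring_nf
  refine ⟨Real.cos_pos_of_mem_Ioo ⟨by linarith, by linarith⟩,
    Real.sin_nonneg_of_nonneg_of_le_pi (by linarith) (by linarith), ?_, ?_⟩
  · rw [hcos]
    exact Real.cos_arctan_pos t
  · rw [hcos, hsin]
    conv_rhs => rw [← Real.tan_arctan t]
    rw [Real.arctan_tan (by linarith) h1, Real.tan_mul_cos (Real.cos_arctan_pos t).ne']

open Classical in
theorem stmt_5 (ρ : ℝ) (hρ : 0 < ρ) (x : Fin 2 → ℝ) (hx1 : 0 ≤ x 1) (hx2 : x 1 < x 0)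
    (θs : ℝ)
    (hθ : θs = if 2 < ρ * x 0 * x 1 then
        (1 / 2) * Real.arctan ((2 * (ρ * x 0 * x 1 - 2)) / (ρ * (x 0 ^ 2 - x 1 ^ 2)))
      else 0)
    (ws : Fin 2 → ℝ) (hws : ws = ![Real.cos θs, Real.sin θs]) :
    ((∑ i, (ws i) ^ 2 = 1) ∧ (∀ i, 0 ≤ ws i) ∧
      (∀ w : Fin 2 → ℝ, (∑ i, (w i) ^ 2 = 1) → (∀ i, 0 ≤ w i) →
        -(ρ / 2) * (∑ i, x i * ws i) ^ 2 + (l1norm ws) ^ 2 ≤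
          -(ρ / 2) * (∑ i, x i * w i) ^ 2 + (l1norm w) ^ 2)) ∧
    (ρ * x 0 * x 1 ≤ 2 ∧ ρ * x 0 ^ 2 < 2 → proxSet ρ h2 x = {0}) ∧
    (ρ * x 0 * x 1 ≤ 2 ∧ ρ * x 0 ^ 2 = 2 → proxSet ρ h2 x = {0, ![x 0, 0]}) ∧
    (ρ * x 0 * x 1 ≤ 2 ∧ 2 < ρ * x 0 ^ 2 → proxSet ρ h2 x = {![x 0, 0]}) ∧
    (2 < ρ * x 0 * x 1 → proxSet ρ h2 x = {(∑ i, x i * ws i) • ws}) := by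
  have hx0 : 0 < x 0 := hx1.trans_lt hx2
  have hsq : 0 < x 0 ^ 2 - x 1 ^ 2 := by nlinarith
  obtain ⟨hc, hs, hmin⟩ : 0 ≤ Real.cos θs ∧ 0 ≤ Real.sin θs ∧
      IsProfileMin ρ (x 0) (x 1) (Real.cos θs) (Real.sin θs) := by
    split_ifs at hθ with h
    · obtain ⟨hc, hs, hcos, htan⟩ := half_arctan_double_angle
        (t := 2 * (ρ * x 0 * x 1 - 2) / (ρ * (x 0 ^ 2 - x 1 ^ 2)))
        (div_nonneg (by linarith) (by positivity))
      rw [← hθ] at hc hs hcos htan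
      refine ⟨hc.le, hs, isProfileMin_of_double_angle hρ hx1 hx2 hc hs
        (Real.cos_sq_add_sin_sq θs) hcos ?_⟩
      rw [htan]
      field_simp
    · rw [hθ, Real.cos_zero, Real.sin_zero]
      exact ⟨zero_le_one, le_rfl, isProfileMin_one_zero hρ hx1 hx2 (not_lt.1 h)⟩
  have hprofile (w : Fin 2 → ℝ) (hw : w 0 ^ 2 + w 1 ^ 2 = 1) :
      -(ρ / 2) * (∑ i, x i * w i) ^ 2 + l1norm w ^ 2 =
        sphereProfile ρ (x 0) (x 1) (w 0) (w 1) := by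
    rw [l1norm_sq_fin_two, hw, Fin.sum_univ_two, sphereProfile]
    ring
  have hone : sphereProfile ρ (x 0) (x 1) 1 0 = 1 - ρ * x 0 ^ 2 / 2 := by
    simp only [sphereProfile, mul_zero, abs_zero]
    ring
  have hproj : (![(x 0 * 1 + x 1 * 0) * 1, (x 0 * 1 + x 1 * 0) * 0] : Fin 2 → ℝ) =
      ![x 0, 0] := by simp
  refine ⟨⟨?_, ?_, ?_⟩, ?_, ?_, ?_, ?_⟩
  · simp [hws, Fin.sum_univ_two]
  · rw [Fin.forall_fin_two, hws]
    exact ⟨hc, hs⟩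
  · intro w hw _
    rw [Fin.sum_univ_two] at hw
    rw [hprofile w hw, hprofile ws (by simp [hws]), hws]
    exact hmin.le _ _ hw
  · rintro ⟨h, h'⟩
    exact (isProfileMin_one_zero hρ hx1 hx2 h).proxSet_eq_of_pos hρ (by linarith)
  · rintro ⟨h, h'⟩
    rw [(isProfileMin_one_zero hρ hx1 hx2 h).proxSet_eq_of_eq_zero hρ (by linarith), hproj]
  · rintro ⟨h, h'⟩
    rw [(isProfileMin_one_zero hρ hx1 hx2 h).proxSet_eq_of_neg hρ (by linarith), hproj]
  · intro h
    have hneg : sphereProfile ρ (x 0) (x 1) (Real.cos θs) (Real.sin θs) < 0 := by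
      have := hmin.le 1 0 (by norm_num)
      nlinarith [mul_pos hρ hx0]
    rw [hmin.proxSet_eq_of_neg hρ hneg, hws]
    simp [Fin.sum_univ_two]
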